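/- Let α > 1 be an irrational real number. Suppose there exists a function ψ : ℝ₊ → ℝ₊ which is decreasing for all sufficiently large x, such that ∫₁^∞ ψ(x)/x dx < ∞ and q^{−1}·‖qα‖ > e^{−q·ψ(q)} for all integers q ≥ 1. Then the series J_α(1) = ∑_{ℓ≥1} B̃₁(αℓ)/ℓ converges (in the sense that its partial sums converge). -/

import Mathlib

open Filter Topology Real MeasureTheory

/-- fract perturbation -/
lemma fract_pert (q : ℕ) (hq : 0 < q) (r : ℕ) (hr : r < q) (t θ : ℝ) (ht0 : 0 ≤ t) (ht1 : t < 1)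
    (hθ : |θ| ≤ 1 / q) :
    |Int.fract ((r + t) / q + θ) - (r + t) / q| ≤
      1 / q + (if r = 0 then 1 else 0) + (if r = q - 1 then 1 else 0) := by
  have hq' : (0:ℝ) < q := by exact_mod_cast hq
  have hr' : (r:ℝ) + 1 ≤ q := by exact_mod_cast hr
  have hiq : (0:ℝ) < 1 / q := by positivity
  have h0 : 0 ≤ (r + t) / q := by positivity
  have h1 : (r + t) / q < 1 := by rw [div_lt_one hq']; linarith
  obtain ⟨ha, hb⟩ := abs_le.mp hθ
  have hf0 := Int.fract_nonneg ((r + t) / q + θ)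
  have hf1 := Int.fract_lt_one ((r + t) / q + θ)
  by_cases c0 : r = 0
  · rw [if_pos c0, abs_le]
    have : (0:ℝ) ≤ (if r = q - 1 then 1 else 0) := by split_ifs <;> norm_num
    constructor <;> linarith
  by_cases c1 : r = q - 1
  · rw [if_pos c1, abs_le]
    have : (0:ℝ) ≤ (if r = 0 then 1 else 0) := by split_ifs <;> norm_num
    constructor <;> linarith
  rw [if_neg c0, if_neg c1]
  have g0 : (1:ℝ) ≤ r := by exact_mod_cast (Nat.one_le_iff_ne_zero.mpr c0)
  have g1 : (r:ℝ) + 2 ≤ q := by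
    have : r + 2 ≤ q := by omega
    exact_mod_cast this
  have k0 : 1 / (q:ℝ) ≤ (r + t) / q := by gcongr; linarith
  have k1 : (r + t) / q + 1 / (q:ℝ) < 1 := by
    rw [← add_div, div_lt_one hq']; linarith
  rw [Int.fract_eq_self.mpr ⟨by linarith, by linarith⟩]
  simpa using hθ

lemma sum_perm (q : ℕ) (hq : 0 < q) (p c : ℤ) (hc : IsCoprime p (q:ℤ)) (f : ℕ → ℝ) :
    ∑ i ∈ Finset.range q, f ((c + p * i) % q).toNat = ∑ r ∈ Finset.range q, f r := by
  have hqz : (0:ℤ) < q := by exact_mod_cast hq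
  have hinj : Set.InjOn (fun i : ℕ => ((c + p * i) % q).toNat) (Finset.range q : Set ℕ) := by
    intro a ha b hb hab
    simp only [Finset.coe_range, Set.mem_Iio] at ha hb
    have e1 := Int.emod_nonneg (c + p * a) hqz.ne'
    have e2 := Int.emod_nonneg (c + p * b) hqz.ne'
    have h : (c + p * a) % q = (c + p * b) % q := by
      simp only at hab; omega
    have h2 : (q:ℤ) ∣ p * (a - b) := by
      have h3 := Int.emod_eq_emod_iff_emod_sub_eq_zero.mp h
      have h4 := Int.dvd_of_emod_eq_zero h3
      rwa [show c + p * (a:ℤ) - (c + p * b) = p * (a - b) by ring] at h4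
    have h3 : (q:ℤ) ∣ (a - b) := hc.symm.dvd_of_dvd_mul_left h2
    have h4 : ((a:ℤ) - b) = 0 := by
      apply Int.eq_zero_of_abs_lt_dvd h3
      rw [abs_lt]; constructor <;> omega
    omega
  rw [← Finset.sum_image (f := f) hinj]
  congr 1
  apply Finset.eq_of_subset_of_card_le
  · intro x hx
    simp only [Finset.mem_image, Finset.mem_range] at hx ⊢
    obtain ⟨i, hi, rfl⟩ := hx
    have e1 := Int.emod_nonneg (c + p * i) hqz.ne'
    have e2 := Int.emod_lt_of_pos (c + p * i) hqz
    omega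
  · rw [Finset.card_image_of_injOn hinj]

lemma block (α x : ℝ) (q : ℕ) (hq : 0 < q) (p : ℤ) (hc : IsCoprime p (q:ℤ))
    (happ : |α - p / q| ≤ 1 / (q * q)) :
    |∑ i ∈ Finset.range q, (Int.fract (x + α * i) - 1 / 2)| ≤ 4 := by
  have hq' : (0:ℝ) < q := by exact_mod_cast hq
  have hqz : (0:ℤ) < q := by exact_mod_cast hq
  set c : ℤ := ⌊q * x⌋ with hcdef
  set t : ℝ := Int.fract (q * x) with htdef
  have ht0 : 0 ≤ t := Int.fract_nonneg _
  have ht1 : t < 1 := Int.fract_lt_one _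
  have hx : x = (c + t) / q := by
    rw [eq_div_iff hq'.ne', hcdef, htdef, Int.floor_add_fract]; ring
  set g : ℕ → ℝ := fun r => ((r:ℝ) + t) / q
  set h : ℕ → ℝ := fun r => 1 / q + (if r = 0 then 1 else 0) + (if r = q - 1 then 1 else 0)
  have key : ∀ i ∈ Finset.range q,
      |Int.fract (x + α * i) - g ((c + p * i) % q).toNat| ≤ h ((c + p * i) % q).toNat := by
    intro i hi
    have hi' : (i:ℝ) ≤ q := by exact_mod_cast (Finset.mem_range.mp hi).le
    have e1 := Int.emod_nonneg (c + p * i) hqz.ne'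
    have e2 := Int.emod_lt_of_pos (c + p * i) hqz
    set r : ℕ := ((c + p * i) % q).toNat with hr
    have hrz : (r:ℤ) = (c + p * i) % q := Int.toNat_of_nonneg e1
    have hrq : r < q := by omega
    set θ : ℝ := (α - p / q) * i with hθ
    have hθ' : |θ| ≤ 1 / q := by
      rw [hθ, abs_mul, Nat.abs_cast]
      calc |α - p / q| * i ≤ 1 / (q * q) * q := by gcongr
        _ = 1 / q := by field_simp
    have hdm := Int.emod_add_mul_ediv (c + p * i) q
    rw [← hrz] at hdm
    have hdm' : (r:ℝ) + q * (((c + p * i) / q : ℤ) : ℝ) = c + p * i := by exact_mod_cast hdm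
    have hz : x + α * i = ((r + t) / q + θ) + (((c + p * i) / q : ℤ) : ℝ) := by
      rw [hx, hθ]
      field_simp
      linear_combination -hdm'
    rw [hz, Int.fract_add_intCast]
    exact fract_pert q hq r hrq t θ ht0 ht1 hθ'
  have hg : ∑ r ∈ Finset.range q, g r = (q - 1) / 2 + t := by
    have : ∑ r ∈ Finset.range q, (r:ℝ) = q * (q - 1) / 2 := by
      clear * -
      induction q with
      | zero => simp
      | succ n ih => rw [Finset.sum_range_succ, ih]; push_cast; ring
    simp only [g]
    rw [← Finset.sum_div, Finset.sum_add_distrib, this]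
    simp
    field_simp
  have hh : ∑ r ∈ Finset.range q, h r = 3 := by
    simp only [h, Finset.sum_add_distrib]
    rw [Finset.sum_ite_eq' , Finset.sum_ite_eq']
    simp [hq, hq'.ne']
    norm_num
  have tot : |∑ i ∈ Finset.range q, (Int.fract (x + α * i) - g ((c + p * i) % q).toNat)| ≤ 3 := by
    calc _ ≤ ∑ i ∈ Finset.range q, |Int.fract (x + α * i) - g ((c + p * i) % q).toNat| :=
          Finset.abs_sum_le_sum_abs _ _
      _ ≤ ∑ i ∈ Finset.range q, h ((c + p * i) % q).toNat := Finset.sum_le_sum key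
      _ = 3 := by rw [sum_perm q hq p c hc h, hh]
  rw [Finset.sum_sub_distrib, sum_perm q hq p c hc g, hg] at tot
  rw [Finset.sum_sub_distrib]
  simp only [Finset.sum_const, Finset.card_range, nsmul_eq_mul]
  rw [abs_le] at tot ⊢
  constructor <;> linarith [tot.1, tot.2]

noncomputable def SS (α : ℝ) (n : ℕ) : ℝ := ∑ i ∈ Finset.range n, (Int.fract (α * ((i + 1 : ℕ) : ℝ)) - 1 / 2)

lemma SS_add (α : ℝ) (q : ℕ) (hq : 0 < q) (p : ℤ) (hc : IsCoprime p (q:ℤ))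
    (happ : |α - p / q| ≤ 1 / (q * q)) (n : ℕ) : |SS α (n + q)| ≤ |SS α n| + 4 := by
  have h := block α (α * (n + 1)) q hq p hc happ
  have : SS α (n + q) = SS α n +
      ∑ i ∈ Finset.range q, (Int.fract (α * (n + 1) + α * i) - 1 / 2) := by
    unfold SS
    rw [Finset.sum_range_add]
    congr 1
    apply Finset.sum_congr rfl
    intro i _
    push_cast
    ring_nf
  rw [this]
  linarith [abs_add_le (SS α n) (∑ i ∈ Finset.range q, (Int.fract (α * (n + 1) + α * i) - 1 / 2))]

lemma SS_mul (α : ℝ) (q : ℕ) (hq : 0 < q) (p : ℤ) (hc : IsCoprime p (q:ℤ))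
    (happ : |α - p / q| ≤ 1 / (q * q)) (n : ℕ) : |SS α n| ≤ |SS α (n % q)| + 4 * (n / q : ℕ) := by
  have : ∀ k r : ℕ, |SS α (r + q * k)| ≤ |SS α r| + 4 * k := by
    intro k r
    induction k with
    | zero => simp
    | succ k ih =>
      have := SS_add α q hq p hc happ (r + q * k)
      rw [show r + q * (k + 1) = r + q * k + q by ring]
      push_cast
      linarith
  have h := this (n / q) (n % q)
  rwa [Nat.mod_add_div] at h

lemma abel (α : ℝ) (N : ℕ) :
    ∑ ℓ ∈ Finset.Icc 1 N, (Int.fract (α * ℓ) - 1 / 2) / (ℓ : ℝ) =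
      SS α N / N + ∑ n ∈ Finset.range N, SS α n / (n * (n + 1)) := by
  induction N with
  | zero => simp
  | succ N ih =>
    rw [Finset.sum_Icc_succ_top (by omega), ih, Finset.sum_range_succ]
    have h : SS α (N + 1) = SS α N + (Int.fract (α * ((N + 1 : ℕ) : ℝ)) - 1 / 2) := by
      unfold SS; rw [Finset.sum_range_succ]
    rw [h]
    rcases Nat.eq_zero_or_pos N with rfl | hN
    · simp [SS]
    · have : (0:ℝ) < N := by exact_mod_cast hN
      push_cast
      field_simp
      ring

lemma conv_of_bound (α : ℝ) (e : ℕ → ℝ) (he : Summable e)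
    (hb : ∀ j n, n ≤ 2 ^ j → |SS α n| ≤ e j * 2 ^ j) :
    ∃ J : ℝ, Tendsto
      (fun N : ℕ => ∑ ℓ ∈ Finset.Icc 1 N, (Int.fract (α * ℓ) - 1 / 2) / (ℓ : ℝ))
      atTop (𝓝 J) := by
  have he0 : ∀ j, 0 ≤ e j := by
    intro j
    have h := (abs_nonneg _).trans (hb j 0 (by positivity))
    exact nonneg_of_mul_nonneg_left h (by positivity)
  have hlog : Tendsto (fun n : ℕ => Nat.log 2 n) atTop atTop := by
    rw [tendsto_atTop]
    intro b
    filter_upwards [eventually_ge_atTop (2 ^ b)] with n hn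
    exact Nat.le_log_of_pow_le (by norm_num) hn
  have h1 : Tendsto (fun n : ℕ => SS α n / n) atTop (𝓝 0) := by
    have h2 : Tendsto (fun n : ℕ => 2 * e (Nat.log 2 n + 1)) atTop (𝓝 0) := by
      have := ((tendsto_add_atTop_iff_nat 1).mpr he.tendsto_atTop_zero).comp hlog
      simpa using this.const_mul 2
    apply squeeze_zero_norm' _ h2
    filter_upwards [eventually_ge_atTop 1] with n hn
    have hn' : (0:ℝ) < n := by exact_mod_cast hn
    have hlt := Nat.lt_pow_succ_log_self (b := 2) (by norm_num) n
    have hle := Nat.pow_log_le_self 2 (x := n) (by omega)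
    have hle' : (2:ℝ) ^ Nat.log 2 n ≤ n := by exact_mod_cast hle
    rw [Real.norm_eq_abs, abs_div, Nat.abs_cast, div_le_iff₀ hn']
    have := hb (Nat.log 2 n + 1) n hlt.le
    rw [pow_succ] at this
    nlinarith [he0 (Nat.log 2 n + 1)]
  have h2 : ∀ J : ℕ, ∑ n ∈ Finset.range (2 ^ J), |SS α n / (n * (n + 1))| ≤
      ∑ j ∈ Finset.range J, 2 * e (j + 1) := by
    intro J
    induction J with
    | zero => simp [SS]
    | succ J ih =>
      rw [Finset.sum_range_succ, pow_succ, mul_two, Finset.sum_range_add]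
      apply add_le_add ih
      have : ∀ i ∈ Finset.range (2 ^ J), |SS α (2 ^ J + i) / (((2 ^ J + i : ℕ) : ℝ) * (((2 ^ J + i : ℕ) : ℝ) + 1))|
          ≤ 2 * e (J + 1) / 2 ^ J := by
        intro i hi
        have hi' := Finset.mem_range.mp hi
        have hs := hb (J + 1) (2 ^ J + i) (by rw [pow_succ]; omega)
        have hp : (0:ℝ) < 2 ^ J := by positivity
        have hm : (2:ℝ) ^ J ≤ ((2 ^ J + i : ℕ) : ℝ) := by push_cast; linarith [(Nat.cast_nonneg i : (0:ℝ) ≤ i)]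
        rw [abs_div, abs_of_nonneg (a := ((2 ^ J + i : ℕ) : ℝ) * (((2 ^ J + i : ℕ) : ℝ) + 1)) (by positivity)]
        calc _ ≤ (e (J + 1) * 2 ^ (J + 1)) / ((2:ℝ) ^ J * 2 ^ J) := by
              gcongr
              · exact mul_nonneg (he0 _) (by positivity)
              · linarith
          _ = _ := by rw [pow_succ]; field_simp
      refine (Finset.sum_le_sum this).trans ?_
      simp
      field_simp
      exact le_refl _
  have h3 : Summable (fun n : ℕ => SS α n / (n * (n + 1))) := by
    apply Summable.of_abs
    have hs : Summable (fun j => 2 * e (j + 1)) := ((summable_nat_add_iff 1).mpr he).mul_left 2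
    apply summable_of_sum_range_le (c := ∑' j, 2 * e (j + 1)) (fun _ => abs_nonneg _)
    intro n
    calc _ ≤ ∑ n ∈ Finset.range (2 ^ n), |SS α n / (n * (n + 1))| := by
          apply Finset.sum_le_sum_of_subset_of_nonneg
          · exact Finset.range_subset_range.mpr (Nat.lt_two_pow_self).le
          · intros; positivity
      _ ≤ _ := h2 n
      _ ≤ _ := hs.sum_le_tsum _ (fun j _ => by have := he0 (j + 1); positivity)
  refine ⟨0 + ∑' n : ℕ, SS α n / (n * (n + 1)), ?_⟩
  simp_rw [abel]
  exact h1.add h3.hasSum.tendsto_sum_nat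

noncomputable def EE (q : ℕ → ℕ) : ℕ → ℝ
  | 0 => 1
  | j + 1 => EE q j / 2 + 4 / q j

lemma EE_summable (q : ℕ → ℕ) (hq : Summable (fun j => 1 / (q j : ℝ))) : Summable (EE q) := by
  have h0 : ∀ j, 0 ≤ EE q j := by
    intro j
    induction j with
    | zero => simp [EE]
    | succ j ih => simp only [EE]; positivity
  apply summable_of_sum_range_le (c := 2 + 8 * ∑' j, 1 / (q j : ℝ)) h0
  intro n
  have hmono : ∑ j ∈ Finset.range n, EE q j ≤ ∑ j ∈ Finset.range (n + 1), EE q j := by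
    rw [Finset.sum_range_succ]; linarith [h0 n]
  have hQ : ∑ j ∈ Finset.range n, 1 / (q j : ℝ) ≤ ∑' j, 1 / (q j : ℝ) :=
    hq.sum_le_tsum _ (fun j _ => by positivity)
  have hrec : ∑ j ∈ Finset.range (n + 1), EE q j =
      (∑ j ∈ Finset.range n, EE q j) / 2 + 4 * ∑ j ∈ Finset.range n, 1 / (q j : ℝ) + 1 := by
    rw [Finset.sum_range_succ', Finset.sum_div, Finset.mul_sum, ← Finset.sum_add_distrib]
    simp only [EE]
    congr 1
    apply Finset.sum_congr rfl
    intros; ring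
  linarith

lemma EE_bound (α : ℝ) (q : ℕ → ℕ) (hq0 : ∀ j, 0 < q j) (hq : ∀ j, q j ≤ 2 ^ j) (p : ℕ → ℤ)
    (hc : ∀ j, IsCoprime (p j) (q j : ℤ)) (happ : ∀ j, |α - p j / q j| ≤ 1 / (q j * q j)) :
    ∀ j n, n ≤ 2 ^ j → |SS α n| ≤ EE q j * 2 ^ j := by
  intro j
  induction j with
  | zero =>
    intro n hn
    simp only [pow_zero] at hn
    simp only [EE]
    interval_cases n
    · simp [SS]
    · simp [SS]
      have := Int.fract_nonneg α
      have := Int.fract_lt_one α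
      rw [abs_le]; constructor <;> linarith
  | succ j ih =>
    intro n hn
    have h1 := SS_mul α (q j) (hq0 j) (p j) (hc j) (happ j) n
    have h2 := ih (n % q j) ((Nat.mod_lt _ (hq0 j)).le.trans (hq j))
    have h3 : ((n / q j : ℕ) : ℝ) ≤ 2 ^ (j + 1) / q j := by
      refine Nat.cast_div_le.trans ?_
      gcongr
      exact_mod_cast hn
    simp only [EE]
    have : (EE q j / 2 + 4 / q j) * 2 ^ (j + 1) = EE q j * 2 ^ j + 4 * (2 ^ (j + 1) / q j) := by
      rw [pow_succ]; ring
    rw [this]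
    linarith

lemma q_summable (q : ℕ → ℕ) (hq0 : ∀ j, 0 < q j) (hq : ∀ j, q j ≤ 2 ^ j) (B : ℕ → ℝ)
    (hB0 : ∀ i, 0 ≤ B i)
    (hB : ∀ j : ℕ, (j:ℝ) * Real.log 2 ≤ B (Nat.log 2 (q j)))
    (hs : Summable (fun i => B i / 2 ^ i)) : Summable (fun j => 1 / (q j : ℝ)) := by
  have hl : 0 < Real.log 2 := Real.log_pos (by norm_num)
  have hs2 : Summable (fun i : ℕ => B i / 2 ^ i / Real.log 2 + (1 / 2) ^ i) :=
    (hs.div_const _).add summable_geometric_two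
  apply summable_of_sum_range_le (c := ∑' i : ℕ, (B i / 2 ^ i / Real.log 2 + (1 / 2) ^ i))
    (fun _ => by positivity)
  intro J
  have hmaps : ∀ j ∈ Finset.range J, Nat.log 2 (q j) ∈ Finset.range J := by
    intro j hj
    have : Nat.log 2 (q j) ≤ j := by
      have := Nat.log_mono_right (b := 2) (hq j)
      rwa [Nat.log_pow (by norm_num)] at this
    simp only [Finset.mem_range] at hj ⊢; omega
  rw [← Finset.sum_fiberwise_of_maps_to hmaps]
  refine le_trans (Finset.sum_le_sum ?_) (hs2.sum_le_tsum (Finset.range J)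
    (fun i _ => by have := hB0 i; positivity))
  intro i _
  have h1 : ∀ j ∈ (Finset.range J).filter (fun j => Nat.log 2 (q j) = i), 1 / (q j : ℝ) ≤ (1 / 2) ^ i := by
    intro j hj
    have hj' := (Finset.mem_filter.mp hj).2
    have hle := Nat.pow_log_le_self 2 (x := q j) (hq0 j).ne'
    rw [hj'] at hle
    have hle' : (2:ℝ) ^ i ≤ q j := by exact_mod_cast hle
    rw [one_div_pow]
    gcongr
  have hcard : (((Finset.range J).filter (fun j => Nat.log 2 (q j) = i)).card : ℝ) ≤ B i / Real.log 2 + 1 := by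
    have hsub : (Finset.range J).filter (fun j => Nat.log 2 (q j) = i) ⊆
        Finset.range (⌊B i / Real.log 2⌋₊ + 1) := by
      intro j hj
      have hj' := (Finset.mem_filter.mp hj).2
      have := hB j
      rw [hj'] at this
      rw [Finset.mem_range, Nat.lt_succ_iff]
      apply Nat.le_floor
      rwa [le_div_iff₀ hl]
    have h := Finset.card_le_card hsub
    rw [Finset.card_range] at h
    have h' : (((Finset.range J).filter (fun j => Nat.log 2 (q j) = i)).card : ℝ) ≤
        (⌊B i / Real.log 2⌋₊ : ℝ) + 1 := by exact_mod_cast h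
    have := Nat.floor_le (a := B i / Real.log 2) (div_nonneg (hB0 i) hl.le)
    linarith
  refine (Finset.sum_le_card_nsmul _ _ _ h1).trans ?_
  rw [nsmul_eq_mul]
  calc _ ≤ (B i / Real.log 2 + 1) * (1 / 2) ^ i := by gcongr
    _ = _ := by rw [one_div_pow]; field_simp

lemma psi_summable (ψ : ℝ → ℝ) (hψpos : ∀ x > 0, 0 < ψ x) (I : ℕ)
    (hdec : ∀ ⦃x y : ℝ⦄, 2 ^ I ≤ x → x ≤ y → ψ y ≤ ψ x)
    (hψint : IntegrableOn (fun x => ψ x / x) (Set.Ici 1)) :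
    Summable (fun i : ℕ => ψ (2 ^ i)) := by
  rw [← summable_nat_add_iff (I + 1)]
  apply summable_of_sum_range_le (c := 2 * ∫ x in Set.Ici 1, ψ x / x)
    (fun i => (hψpos _ (by positivity)).le)
  intro n
  have hii : ∀ a b : ℝ, 1 ≤ a → a ≤ b → IntervalIntegrable (fun x => ψ x / x) volume a b := by
    intro a b ha hab
    rw [intervalIntegrable_iff_integrableOn_Ioc_of_le hab]
    apply hψint.mono_set
    intro x hx
    exact ha.trans hx.1.le
  have h1 : ∀ k : ℕ, (1:ℝ) ≤ 2 ^ k := fun k => one_le_pow₀ (by norm_num)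
  have hmono : ∀ a b : ℕ, a ≤ b → (2:ℝ) ^ a ≤ 2 ^ b := fun a b h =>
    pow_le_pow_right₀ (by norm_num) h
  have hstep : ∀ k ∈ Finset.range n, ψ (2 ^ (k + (I + 1))) ≤
      2 * ∫ x in (2:ℝ) ^ (k + I)..2 ^ (k + 1 + I), ψ x / x := by
    intro k _
    have hle : (2:ℝ) ^ (k + I) ≤ 2 ^ (k + 1 + I) := hmono _ _ (by omega)
    have := intervalIntegral.integral_mono_on
      (f := fun _ => ψ (2 ^ (k + 1 + I)) / 2 ^ (k + 1 + I)) (g := fun x => ψ x / x)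
      hle (by simp) (hii _ _ (h1 _) hle) (by
        intro x hx
        have hx0 : 0 < x := lt_of_lt_of_le (by positivity) hx.1
        have ha := hdec ((hmono I (k + I) (by omega)).trans hx.1) hx.2
        have hp := hψpos x hx0
        have := hx.2
        gcongr)
    rw [intervalIntegral.integral_const, smul_eq_mul] at this
    have he : ((2:ℝ) ^ (k + 1 + I) - 2 ^ (k + I)) * (ψ (2 ^ (k + 1 + I)) / 2 ^ (k + 1 + I)) =
        ψ (2 ^ (k + 1 + I)) / 2 := by
      have : (2:ℝ) ^ (k + 1 + I) = 2 * 2 ^ (k + I) := by ring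
      generalize ψ (2 ^ (k + 1 + I)) = u
      rw [this]
      field_simp
      ring
    rw [he] at this
    rw [show k + (I + 1) = k + 1 + I by ring]
    linarith
  refine (Finset.sum_le_sum hstep).trans ?_
  rw [← Finset.mul_sum]
  gcongr
  rw [intervalIntegral.sum_integral_adjacent_intervals (a := fun k => (2:ℝ) ^ (k + I))
    (fun k _ => hii _ _ (h1 _) (hmono _ _ (by omega))),
    intervalIntegral.integral_of_le (hmono _ _ (by omega))]
  apply setIntegral_mono_set hψint
  · filter_upwards [ae_restrict_mem measurableSet_Ici] with x hx
    have hx0 : (0:ℝ) < x := lt_of_lt_of_le one_pos hx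
    exact (div_pos (hψpos x hx0) hx0).le
  · apply HasSubset.Subset.eventuallyLE
    intro x hx
    exact (h1 _).trans hx.1.le

theorem stmt3 (α : ℝ) (hα : 1 < α) (hirr : Irrational α)
    (ψ : ℝ → ℝ) (hψpos : ∀ x > 0, 0 < ψ x)
    (hψdec : ∃ X : ℝ, ∀ ⦃x y : ℝ⦄, X ≤ x → x ≤ y → ψ y ≤ ψ x)
    (hψint : IntegrableOn (fun x => ψ x / x) (Set.Ici 1))
    (happrox : ∀ q : ℕ, 1 ≤ q →
      Real.exp (-(q * ψ q)) < (q : ℝ)⁻¹ * |(q : ℝ) * α - round ((q : ℝ) * α)|) :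
    ∃ J : ℝ, Tendsto
      (fun N : ℕ => ∑ ℓ ∈ Finset.Icc 1 N, (Int.fract (α * ℓ) - 1 / 2) / (ℓ : ℝ))
      atTop (𝓝 J) := by
  obtain ⟨X, hX⟩ := hψdec
  obtain ⟨I, hI⟩ := pow_unbounded_of_one_lt X (one_lt_two)
  have hdec : ∀ ⦃x y : ℝ⦄, 2 ^ I ≤ x → x ≤ y → ψ y ≤ ψ x := fun x y h => hX (hI.le.trans h)
  have hψs := psi_summable ψ hψpos I hdec hψint
  have hdir : ∀ j : ℕ, ∃ r : ℚ, |α - r| ≤ 1 / ((((2 ^ j : ℕ) : ℝ) + 1) * r.den) ∧ r.den ≤ 2 ^ j :=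
    fun j => Real.exists_rat_abs_sub_le_and_den_le α (by positivity)
  choose r hr1 hr2 using hdir
  have hr0 : ∀ j, (0:ℝ) < (r j).den := fun j => by exact_mod_cast (r j).den_pos
  have hrd : ∀ j, ((r j : ℚ) : ℝ) = (r j).num / (r j).den := fun j => Rat.cast_def _
  have happ : ∀ j, |α - (r j).num / (r j).den| ≤ 1 / ((r j).den * (r j).den) := by
    intro j
    rw [← hrd]
    refine (hr1 j).trans ?_
    have := hr0 j
    have h2 : ((r j).den : ℝ) ≤ ((2 ^ j : ℕ) : ℝ) := by exact_mod_cast hr2 j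
    gcongr
    linarith
  have hj : ∀ j : ℕ, (j:ℝ) * Real.log 2 ≤ (r j).den * ψ (r j).den := by
    intro j
    have h0 := hr0 j
    have h := happrox (r j).den (r j).den_pos
    have h2 : |((r j).den : ℝ) * α - round (((r j).den : ℝ) * α)| ≤ 1 / 2 ^ j := by
      refine (round_le _ (r j).num).trans ?_
      have : ((r j).den : ℝ) * α - (r j).num = (r j).den * (α - r j) := by
        rw [hrd]; field_simp
      rw [this, abs_mul, Nat.abs_cast]
      calc _ ≤ ((r j).den : ℝ) * (1 / ((((2 ^ j : ℕ) : ℝ) + 1) * (r j).den)) := by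
            gcongr; exact hr1 j
        _ = 1 / (((2 ^ j : ℕ) : ℝ) + 1) := by field_simp
        _ ≤ _ := by push_cast; gcongr; linarith
    have h3 : (((r j).den : ℝ))⁻¹ ≤ 1 := inv_le_one_of_one_le₀ (by exact_mod_cast (r j).den_pos)
    have h4 : Real.exp (-((r j).den * ψ (r j).den)) < 1 / 2 ^ j := by
      refine h.trans_le ?_
      calc _ ≤ 1 * (1 / (2:ℝ) ^ j) := by gcongr
        _ = _ := one_mul _
    have h5 := Real.log_lt_log (Real.exp_pos _) h4
    rw [Real.log_exp, one_div, Real.log_inv, Real.log_pow] at h5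
    linarith
  set B : ℕ → ℝ := fun i => if I ≤ i then 2 ^ (i + 1) * ψ (2 ^ i) else
    ∑ q ∈ Finset.range (2 ^ (i + 1)), (q:ℝ) * ψ q with hBdef
  have hnn : ∀ q : ℕ, 0 ≤ (q:ℝ) * ψ q := by
    intro q
    rcases Nat.eq_zero_or_pos q with rfl | hq
    · simp
    · have : (0:ℝ) < q := by exact_mod_cast hq
      exact (mul_pos this (hψpos _ this)).le
  have hB0 : ∀ i, 0 ≤ B i := by
    intro i
    simp only [hBdef]
    split_ifs
    · have := hψpos (2 ^ i) (by positivity)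
      positivity
    · exact Finset.sum_nonneg (fun q _ => hnn q)
  have hB : ∀ q : ℕ, 0 < q → (q:ℝ) * ψ q ≤ B (Nat.log 2 q) := by
    intro q hq
    have hlt := Nat.lt_pow_succ_log_self (b := 2) (by norm_num) q
    have hle := Nat.pow_log_le_self 2 (x := q) (by omega)
    have hle' : (2:ℝ) ^ Nat.log 2 q ≤ q := by exact_mod_cast hle
    have hlt' : (q:ℝ) ≤ (2:ℝ) ^ (Nat.log 2 q + 1) := by exact_mod_cast hlt.le
    simp only [hBdef]
    split_ifs with hi
    · have h1 := hdec (pow_le_pow_right₀ (by norm_num) hi) hle'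
      have h2 := hψpos q (by exact_mod_cast hq)
      gcongr
    · exact Finset.single_le_sum (f := fun q : ℕ => (q:ℝ) * ψ q) (fun q _ => hnn q)
        (Finset.mem_range.mpr hlt)
  have hBs : Summable (fun i => B i / 2 ^ i) := by
    rw [← summable_nat_add_iff I]
    have := ((summable_nat_add_iff I).mpr hψs).mul_left 2
    refine this.congr ?_
    intro i
    simp only [hBdef, if_pos (Nat.le_add_left I i)]
    generalize ψ (2 ^ (i + I)) = u
    rw [pow_succ]
    field_simp
  have hqs := q_summable (fun j => (r j).den) (fun j => (r j).den_pos) hr2 B hB0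
    (fun j => (hj j).trans (hB _ (r j).den_pos)) hBs
  exact conv_of_bound α _ (EE_summable _ hqs)
    (EE_bound α _ (fun j => (r j).den_pos) hr2 (fun j => (r j).num)
      (fun j => by
        rw [Int.isCoprime_iff_gcd_eq_one]
        exact (r j).reduced) happ)
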